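/- arXiv:2208.04093 — 3 statements merged into one kernel-verified Lean document; each statement's English description precedes it below -/
import Mathlib

section
/- Let m ≥ 1 and let X = [0,1]^m be the unit cube in ℝ^m with its usual topology, and endow the space C(X) of continuous self-maps of X with the compact-open topology. Then every non-empty open subset of C(X) contains a continuous map f : X → X such that for every n ≥ 2 there is no map g : X → X (not even a discontinuous one) with gⁿ = f. -/
open Set in
theorem no_root {X : Type*} (f : X → X) (x0 : X) (h0 : f x0 ≠ x0)
    (hc : ∀ w, w ≠ x0 → (f ⁻¹' {w}).Countable)
    (hu : ¬ (f ⁻¹' {x0} ∩ range f).Countable) (n : ℕ) (hn : 2 ≤ n) :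
    ¬ ∃ g : X → X, g^[n] = f := by
  rintro ⟨g, hg⟩
  obtain ⟨k, rfl⟩ : ∃ k, n = k + 2 := ⟨n - 2, by omega⟩
  have hf1 : ∀ x, f x = g^[k+1] (g x) := fun x => by rw [← hg]; rfl
  have hf2 : ∀ x, f x = g^[k] (g (g x)) := fun x => by rw [← hg]; rfl
  have hcomm : ∀ x, f (g x) = g (f x) := fun x => by
    rw [← hg]; exact Function.Commute.iterate_self g (k + 2) x
  have hux : g x0 ≠ x0 := fun h => h0 (by rw [← hg]; exact Function.iterate_fixed h _)
  have hD := hc _ hux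
  set D := f ⁻¹' {g x0} with hDdef
  have hE : (⋃ w ∈ D \ {x0}, f ⁻¹' {w}).Countable :=
    (hD.mono sdiff_subset).biUnion fun w hw => hc w hw.2
  set E := ⋃ w ∈ D \ {x0}, f ⁻¹' {w} with hEdef
  have hB2 : (⋃ y ∈ E, {b | f (f b) = x0 ∧ g b = y}).Countable := by
    refine hE.biUnion fun y _ => ?_
    rcases Set.eq_empty_or_nonempty {b | f (f b) = x0 ∧ g b = y} with h | ⟨b0, hb0, hb1⟩
    · rw [h]; exact countable_empty
    · have hw : f b0 ≠ x0 := fun h => h0 (by rw [h] at hb0; exact hb0)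
      refine (hc _ hw).mono ?_
      rintro b ⟨_, hb⟩
      show f b = f b0
      rw [hf1 b, hf1 b0, hb, hb1]
  apply hu
  refine ((hB2.image f).union (hD.image (g^[k]))).mono ?_
  rintro a ⟨ha, b, rfl⟩
  have hb : f (f b) = x0 := ha
  have h2 : f (f (g b)) = g x0 := by rw [hcomm, hcomm, hb]
  by_cases hA : f (g b) = x0
  · right
    refine ⟨g (g b), ?_, (hf2 b).symm⟩
    show f (g (g b)) = g x0
    rw [hcomm, hA]
  · left
    refine ⟨b, ?_, rfl⟩
    simp only [mem_iUnion]
    refine ⟨g b, ?_, hb, rfl⟩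
    simp only [hEdef, mem_iUnion]
    exact ⟨f (g b), ⟨h2, hA⟩, rfl⟩

open MvPolynomial in
theorem integral_aux {m : ℕ} {B : Type*} [CommRing B] [Algebra ℝ B]
    (φ : MvPolynomial (Fin m) ℝ →ₐ[ℝ] B) (N : ℕ) (R : Fin m → MvPolynomial (Fin m) ℝ)
    (hR : ∀ i, (R i).totalDegree < N) (h : ∀ i, φ (X i) ^ N = φ (R i)) (i : Fin m) :
    IsIntegral ℝ (φ (X i)) := by
  classical
  set T : Set (Fin m →₀ ℕ) := {s | ∀ i, s i < N} with hT
  have hTf : T.Finite := by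
    refine Set.Finite.subset (Set.finite_Iic (Finsupp.equivFunOnFinite.symm fun _ => N)) ?_
    intro s hs
    intro j
    exact (hs j).le
  set W : Submodule ℝ B := Submodule.span ℝ ((fun s => φ (monomial s 1)) '' T) with hW
  have key : ∀ d, ∀ p : MvPolynomial (Fin m) ℝ, p.totalDegree < d → φ p ∈ W := by
    intro d
    induction d with
    | zero => intro p hp; omega
    | succ d ih =>
      intro p hp
      rw [← support_sum_monomial_coeff p, map_sum]
      refine Submodule.sum_mem _ fun s hs => ?_
      have hsd := le_totalDegree hs
      by_cases hsT : s ∈ T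
      · have : monomial s (coeff s p) = coeff s p • monomial s (1:ℝ) := by
          rw [smul_monomial, smul_eq_mul, mul_one]
        rw [this, map_smul]
        exact W.smul_mem _ (Submodule.subset_span ⟨s, hsT, rfl⟩)
      · simp only [hT, Set.mem_ofPred_eq, not_forall, not_lt] at hsT
        obtain ⟨j, hj⟩ := hsT
        have hle : Finsupp.single j N ≤ s := by simpa using hj
        obtain ⟨t, rfl⟩ := exists_add_of_le hle
        have e : monomial (Finsupp.single j N + t) (coeff (Finsupp.single j N + t) p)
            = X j ^ N * monomial t (coeff (Finsupp.single j N + t) p) := by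
          rw [X_pow_eq_monomial, monomial_mul, one_mul]
        rw [e, map_mul, map_pow, h, ← map_mul]
        apply ih
        have h1 := totalDegree_mul (R j) (monomial t (coeff (Finsupp.single j N + t) p))
        have h2 := totalDegree_monomial_le t (coeff (Finsupp.single j N + t) p)
        have h3 : (Finsupp.single j N + t).sum (fun _ e => e) = N + t.sum fun _ e => e := by
          rw [Finsupp.sum_add_index' (by simp) (by simp)]; simp
        have := hR j
        have h4 : t.sum (fun _ => (id : ℕ → ℕ)) = t.sum fun _ e => e := rfl
        omega
  refine IsIntegral.of_mem_of_fg φ.range ?_ _ ⟨X i, rfl⟩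
  have : Subalgebra.toSubmodule φ.range = W := by
    apply le_antisymm
    · rintro _ ⟨p, rfl⟩
      exact key _ p (Nat.lt_succ_self _)
    · refine Submodule.span_le.2 ?_
      rintro _ ⟨s, -, rfl⟩
      exact ⟨_, rfl⟩
  rw [this]
  exact Submodule.fg_span (hTf.image _)

open MvPolynomial in
theorem zeros_finite {m : ℕ} (N : ℕ) (ε : ℝ) (hε : ε ≠ 0) (P : Fin m → MvPolynomial (Fin m) ℝ)
    (hP : ∀ i, (P i).totalDegree < N) :
    {x : Fin m → ℝ | ∀ i, eval x (P i) + ε * x i ^ N = 0}.Finite := by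
  set Z := {x : Fin m → ℝ | ∀ i, eval x (P i) + ε * x i ^ N = 0} with hZ
  let φ : MvPolynomial (Fin m) ℝ →ₐ[ℝ] (Z → ℝ) := aeval fun i z => z.1 i
  have hφ : ∀ p z, φ p z = eval z.1 p := by
    intro p z
    have : (Pi.evalAlgHom ℝ (fun _ : Z => ℝ) z).comp φ = aeval z.1 := by
      ext i; simp [φ]
    have := congrArg (fun ψ => ψ p) this
    simpa [aeval_eq_eval] using this
  have hint := integral_aux φ N (fun i => C (-ε⁻¹) * P i)
    (fun i => by
      have := totalDegree_mul (C (-ε⁻¹)) (P i)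
      rw [totalDegree_C] at this
      have := hP i
      omega)
    (fun i => by
      ext z
      rw [Pi.pow_apply, hφ, hφ]
      have := z.2 i
      simp only [eval_X, map_mul, eval_C]
      field_simp
      linarith)
  have hfin : ∀ i, ∃ S : Set ℝ, S.Finite ∧ ∀ z ∈ Z, z i ∈ S := by
    intro i
    obtain ⟨p, hp, hp0⟩ := hint i
    refine ⟨{t | p.IsRoot t}, Polynomial.finite_setOfPred_isRoot hp.ne_zero, fun z hz => ?_⟩
    have h1 : (Polynomial.aeval (φ (X i))) p = 0 := hp0
    have := congrArg (Pi.evalAlgHom ℝ (fun _ : Z => ℝ) ⟨z, hz⟩) h1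
    rw [← Polynomial.aeval_algHom_apply] at this
    simpa [hφ, Polynomial.IsRoot, Polynomial.aeval_def, Polynomial.eval₂_eq_eval_map] using this
  choose S hS hS2 using hfin
  exact (Set.Finite.pi' hS).subset fun z hz i => hS2 i z hz

abbrev CubeX (m : ℕ) := {x : Fin m → ℝ // ∀ i, x i ∈ Set.Icc (0 : ℝ) 1}

instance cubeX_compact (m : ℕ) : CompactSpace (CubeX m) := by
  have : IsCompact {x : Fin m → ℝ | ∀ i, x i ∈ Set.Icc (0 : ℝ) 1} :=
    isCompact_pi_infinite fun _ => isCompact_Icc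
  exact isCompact_iff_compactSpace.1 this

/-- the point `a + t (x - a)` of the cube -/
def cubeSeg {m : ℕ} (a x : CubeX m) (t : ℝ) (ht : t ∈ Set.Icc (0 : ℝ) 1) : CubeX m :=
  ⟨a.1 + t • (x.1 - a.1), fun i => by
    have ha := a.2 i
    have hx := x.2 i
    simp only [Pi.add_apply, Pi.smul_apply, Pi.sub_apply, smul_eq_mul, Set.mem_Icc] at *
    constructor <;> nlinarith [mul_nonneg ht.1 hx.1, mul_nonneg (sub_nonneg.2 ht.2) ha.1,
      mul_nonneg ht.1 (sub_nonneg.2 hx.2), mul_nonneg (sub_nonneg.2 ht.2) (sub_nonneg.2 ha.2)]⟩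

theorem cubeSeg_val {m : ℕ} (a x : CubeX m) (t : ℝ) (ht : t ∈ Set.Icc (0 : ℝ) 1) :
    (cubeSeg a x t ht).1 = a.1 + t • (x.1 - a.1) := rfl

theorem cube_open_uncountable {m : ℕ} (hm : 1 ≤ m) (V : Set (CubeX m)) (hV : IsOpen V)
    (hne : V.Nonempty) : ¬ V.Countable := by
  intro hc
  obtain ⟨v, hv⟩ := hne
  obtain ⟨w, hw⟩ : ∃ w : CubeX m, w ≠ v := by
    by_contra! h
    have h0 := h ⟨fun _ => 0, fun _ => by simp⟩
    have h1 := h ⟨fun _ => 1, fun _ => by simp⟩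
    have := congrArg (fun x : CubeX m => x.1 ⟨0, hm⟩) (h0.trans h1.symm)
    simp at this
  obtain ⟨ρ, hρ, hb⟩ := Metric.isOpen_iff.1 hV v hv
  have hwv : w.1 - v.1 ≠ 0 := fun h => hw (Subtype.ext (sub_eq_zero.1 h))
  have hpos : 0 < ‖w.1 - v.1‖ := norm_pos_iff.2 hwv
  set η := min 1 (ρ / 2 / ‖w.1 - v.1‖) with hη
  have hη0 : 0 < η := by positivity
  have hmem : ∀ t ∈ Set.Icc 0 η, t ∈ Set.Icc (0 : ℝ) 1 := fun t ht =>
    ⟨ht.1, ht.2.trans (min_le_left _ _)⟩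
  let γ : Set.Icc 0 η → CubeX m := fun t => cubeSeg v w t.1 (hmem _ t.2)
  have hinj : Function.Injective γ := by
    intro s t hst
    have h1 : v.1 + s.1 • (w.1 - v.1) = v.1 + t.1 • (w.1 - v.1) := congrArg Subtype.val hst
    exact Subtype.ext (smul_left_injective ℝ hwv (add_left_cancel h1))
  have hmaps : ∀ t, γ t ∈ V := by
    intro t
    apply hb
    rw [Metric.mem_ball, Subtype.dist_eq, dist_eq_norm]
    have : (γ t).1 - v.1 = t.1 • (w.1 - v.1) := by simp [γ, cubeSeg_val]
    rw [this, norm_smul, Real.norm_of_nonneg t.2.1]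
    have h2 : t.1 ≤ ρ / 2 / ‖w.1 - v.1‖ := t.2.2.trans (min_le_right _ _)
    rw [le_div_iff₀ hpos] at h2
    linarith
  have h1 : (γ ⁻¹' V).Countable := hc.preimage hinj
  have h2 : γ ⁻¹' V = Set.univ := Set.eq_univ_of_forall hmaps
  rw [h2, Set.countable_univ_iff] at h1
  have : (Set.Icc 0 η).Countable := h1
  rw [Cardinal.Real.Icc_countable_iff] at this
  linarith

/-- A finite-to-one (and finitely many fixed points) map near any given one. -/
theorem exists_poly_map {m : ℕ} (h : C(CubeX m, CubeX m)) (ε : ℝ) (hε : 0 < ε) :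
    ∃ q : C(CubeX m, CubeX m), (∀ x, dist (q x) (h x) < ε) ∧
      (∀ w, (q ⁻¹' {w}).Countable) ∧ {x | q x = x}.Countable := by
  classical
  let coord : Fin m → C(CubeX m, ℝ) := fun i => ⟨fun x => x.1 i,
    (continuous_apply i).comp continuous_subtype_val⟩
  let A : Subalgebra ℝ C(CubeX m, ℝ) := (MvPolynomial.aeval (R := ℝ) coord).range
  have hA : A.SeparatesPoints := by
    intro x y hxy
    obtain ⟨i, hi⟩ : ∃ i, x.1 i ≠ y.1 i := by
      by_contra! hh
      exact hxy (Subtype.ext (funext hh))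
    exact ⟨coord i, ⟨coord i, ⟨MvPolynomial.X i, by simp⟩, rfl⟩, hi⟩
  obtain ⟨η, hη, hη1, hη2⟩ : ∃ η : ℝ, 0 < η ∧ η < 1 / 8 ∧ 6 * η < ε :=
    ⟨min (1 / 16) (ε / 12), by positivity, by
      have := min_le_left (1 / 16 : ℝ) (ε / 12); linarith, by
      have := min_le_right (1 / 16 : ℝ) (ε / 12); linarith⟩
  have happ : ∀ i, ∃ P : MvPolynomial (Fin m) ℝ, ∀ x : CubeX m,
      |MvPolynomial.eval x.1 P - ((1 - 4 * η) * (h x).1 i + 2 * η)| < η := by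
    intro i
    obtain ⟨⟨g, P, hP⟩, hg⟩ :=
      ContinuousMap.exists_mem_subalgebra_near_continuousMap_of_separatesPoints A hA
        ⟨fun x => (1 - 4 * η) * (h x).1 i + 2 * η, by
          have hci : Continuous fun x => (h x).1 i :=
            (continuous_apply i).comp (continuous_subtype_val.comp h.continuous)
          exact (continuous_const.mul hci).add continuous_const⟩ η hη
    refine ⟨P, fun x => ?_⟩
    have h1 := (ContinuousMap.norm_lt_iff _ hη).1 hg x
    have h2 : g x = MvPolynomial.eval x.1 P := by
      rw [← hP]
      have : (ContinuousMap.evalAlgHom ℝ ℝ x).comp (MvPolynomial.aeval (R := ℝ) coord)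
          = MvPolynomial.aeval x.1 := by
        ext j; simp [coord]
      have := congrArg (fun ψ => ψ P) this
      simpa [MvPolynomial.aeval_eq_eval] using this
    simpa [h2] using h1
  choose P hP using happ
  set N := 2 + Finset.univ.sup (fun i => (P i).totalDegree) with hN
  have hPN : ∀ i, (P i).totalDegree < N := fun i => by
    have := Finset.le_sup (f := fun i => (P i).totalDegree) (Finset.mem_univ i)
    omega
  let Q : Fin m → (Fin m → ℝ) → ℝ := fun i x => MvPolynomial.eval x (P i) + η * x i ^ N
  have hQ0 : ∀ x : CubeX m, ∀ i, 0 ≤ x.1 i ^ N ∧ x.1 i ^ N ≤ 1 := fun x i =>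
    ⟨pow_nonneg (x.2 i).1 _, pow_le_one₀ (x.2 i).1 (x.2 i).2⟩
  have hQ : ∀ x : CubeX m, ∀ i, Q i x.1 ∈ Set.Icc (0 : ℝ) 1 ∧ |Q i x.1 - (h x).1 i| ≤ 6 * η := by
    intro x i
    have h1 := abs_lt.1 (hP i x)
    have h2 := hQ0 x i
    have h3 := (h x).2 i
    have h4 : 0 ≤ η * x.1 i ^ N := mul_nonneg hη.le h2.1
    have h5 : η * x.1 i ^ N ≤ η := by nlinarith [h2.2]
    have h6 : 0 ≤ η * (h x).1 i := mul_nonneg hη.le h3.1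
    have h7 : η * (h x).1 i ≤ η := by nlinarith [h3.2]
    have h8 := h3.1
    have h9 := h3.2
    simp only [Q]
    refine ⟨⟨by nlinarith, by nlinarith⟩, abs_le.2 ⟨by nlinarith, by nlinarith⟩⟩
  have hQc : ∀ i, Continuous (Q i) := fun i => by
    have := MvPolynomial.continuous_eval (P i)
    fun_prop
  let q : C(CubeX m, CubeX m) := ⟨fun x => ⟨fun i => Q i x.1, fun i => (hQ x i).1⟩, by
    refine Continuous.subtype_mk (continuous_pi fun i => (hQc i).comp continuous_subtype_val) _⟩
  refine ⟨q, fun x => ?_, fun w => ?_, ?_⟩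
  · rw [Subtype.dist_eq]
    refine lt_of_le_of_lt ((dist_pi_le_iff (by positivity)).2 fun i => ?_) hη2
    rw [Real.dist_eq]
    exact (hQ x i).2
  · have := zeros_finite N η hη.ne' (fun i => P i - MvPolynomial.C (w.1 i)) (fun i => by
      have h1 := MvPolynomial.totalDegree_sub (P i) (MvPolynomial.C (w.1 i))
      rw [MvPolynomial.totalDegree_C] at h1
      have := hPN i
      simp at h1
      omega)
    refine (this.countable.preimage (Subtype.val_injective)).mono ?_
    intro x hx i
    have hx' : q x = w := hx
    have h2 : Q i x.1 = w.1 i := congrArg (fun y : CubeX m => y.1 i) hx'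
    simp only [Q] at h2
    simp only [map_sub, MvPolynomial.eval_C]
    linarith
  · have := zeros_finite N η hη.ne' (fun i => P i - MvPolynomial.X i) (fun i => by
      have h1 := MvPolynomial.totalDegree_sub (P i) (MvPolynomial.X i)
      rw [MvPolynomial.totalDegree_X] at h1
      have := hPN i
      rcases le_max_iff.1 h1 with h | h <;> omega)
    refine (this.countable.preimage (Subtype.val_injective)).mono ?_
    intro x hx i
    have hx' : q x = x := hx
    have h2 : Q i x.1 = x.1 i := congrArg (fun y : CubeX m => y.1 i) hx'
    simp only [Q] at h2
    simp only [map_sub, MvPolynomial.eval_X]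
    linarith

/-- Collapse a small ball around `a` to the point `a`. -/
theorem exists_collapse {m : ℕ} (a : CubeX m) (δ : ℝ) (hδ : 0 < δ) :
    ∃ r : C(CubeX m, CubeX m), (∀ x, dist (r x) x ≤ 2 * δ) ∧
      (∀ x, dist x a < δ → r x = a) ∧ (∀ x, 2 * δ ≤ dist x a → r x = x) ∧
      (∀ x y, r x = r y → r x ≠ a → x = y) := by
  let s : ℝ → ℝ := fun t => max 0 (min 1 ((t - δ) / δ))
  have hs : ∀ t, s t ∈ Set.Icc (0 : ℝ) 1 := fun t =>
    ⟨le_max_left _ _, max_le zero_le_one (min_le_left _ _)⟩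
  have hmono : Monotone s := fun t u htu => by
    simp only [s]; gcongr
  have hsc : Continuous s := by fun_prop
  let r : C(CubeX m, CubeX m) := ⟨fun x => cubeSeg a x (s (dist x a)) (hs _), by
    refine Continuous.subtype_mk ?_ _
    fun_prop⟩
  have hr : ∀ x, (r x).1 = a.1 + s (dist x a) • (x.1 - a.1) := fun x => rfl
  have hone : ∀ t, 2 * δ ≤ t → s t = 1 := fun t ht => by
    have : 1 ≤ (t - δ) / δ := by rw [le_div_iff₀ hδ]; linarith
    simp [s, min_eq_left this]
  have hid : ∀ x, 2 * δ ≤ dist x a → r x = x := fun x hx => by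
    apply Subtype.ext
    rw [hr, hone _ hx]; simp
  have hnorm : ∀ x, dist (r x) a = s (dist x a) * dist x a := fun x => by
    rw [Subtype.dist_eq, dist_eq_norm, hr, add_sub_cancel_left, norm_smul,
      Real.norm_of_nonneg (hs _).1, ← dist_eq_norm]; rfl
  refine ⟨r, fun x => ?_, fun x hx => ?_, hid, ?_⟩
  · rcases le_total (2 * δ) (dist x a) with h | h
    · rw [hid x h, dist_self]; positivity
    · have h1 : (r x).1 - x.1 = (s (dist x a) - 1) • (x.1 - a.1) := by
        rw [hr, sub_smul, one_smul]; abel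
      have h2 : dist x a = ‖x.1 - a.1‖ := by rw [Subtype.dist_eq, dist_eq_norm]
      have h3 : dist (r x) x = (1 - s (dist x a)) * dist x a := by
        rw [Subtype.dist_eq, dist_eq_norm, h1, norm_smul, ← h2, Real.norm_eq_abs, abs_sub_comm,
          abs_of_nonneg (sub_nonneg.2 (hs _).2)]
      rw [h3]
      nlinarith [(hs (dist x a)).1, dist_nonneg (x := x) (y := a)]
  · apply Subtype.ext
    have : (dist x a - δ) / δ ≤ 0 := div_nonpos_of_nonpos_of_nonneg (by linarith) hδ.le
    have h0 : s (dist x a) = 0 := max_eq_left ((min_le_right _ _).trans this)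
    rw [hr, h0]; simp
  · have hlt : ∀ x y, r x ≠ a → dist x a < dist y a → dist (r x) a < dist (r y) a := by
      intro x y hx hxy
      have h1 : 0 < dist (r x) a := dist_pos.2 hx
      rw [hnorm] at h1 ⊢
      rw [hnorm]
      have h2 : 0 < s (dist x a) := pos_of_mul_pos_left h1 dist_nonneg
      have h3 := hmono hxy.le
      nlinarith [dist_nonneg (x := x) (y := a)]
    intro x y hxy hx
    have heq : dist x a = dist y a := by
      rcases lt_trichotomy (dist x a) (dist y a) with h | h | h
      · have := hlt x y hx h; rw [hxy] at this; exact absurd this (lt_irrefl _)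
      · exact h
      · have := hlt y x (hxy ▸ hx) h; rw [hxy] at this; exact absurd this (lt_irrefl _)
    have h1 : 0 < dist (r x) a := dist_pos.2 hx
    rw [hnorm] at h1
    have h2 : 0 < s (dist x a) := pos_of_mul_pos_left h1 dist_nonneg
    have h3 := congrArg Subtype.val hxy
    rw [hr, hr, ← heq] at h3
    have h4 := smul_right_injective _ h2.ne' (add_left_cancel h3)
    exact Subtype.ext (sub_left_injective h4)

/-- **Theorem 1(i).** For `X = [0,1]^m` (the unit cube in `ℝ^m` with its
subspace topology), every non-empty open subset of `C(X)` (with the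
compact-open topology) contains a continuous self-map having no iterative
root (even discontinuous) of any order `n ≥ 2`. -/
theorem cube_open_set_contains_map_without_roots (m : ℕ) (hm : 1 ≤ m)
    (U : Set C({x : Fin m → ℝ // ∀ i, x i ∈ Set.Icc (0 : ℝ) 1},
                {x : Fin m → ℝ // ∀ i, x i ∈ Set.Icc (0 : ℝ) 1}))
    (hU : IsOpen U) (hUne : U.Nonempty) :
    ∃ f ∈ U, ∀ n : ℕ, 2 ≤ n →
      ¬ ∃ g : {x : Fin m → ℝ // ∀ i, x i ∈ Set.Icc (0 : ℝ) 1} →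
              {x : Fin m → ℝ // ∀ i, x i ∈ Set.Icc (0 : ℝ) 1},
          g^[n] = ⇑f := by
  classical
  obtain ⟨h, hh⟩ := hUne
  obtain ⟨ε, hε, hball⟩ := Metric.isOpen_iff.1 hU h hh
  obtain ⟨q, hq, hfib, hfix⟩ := exists_poly_map h (ε / 2) (by positivity)
  -- preimages of countable sets are countable
  have hpre : ∀ S : Set (CubeX m), S.Countable → (q ⁻¹' S).Countable := by
    intro S hS
    rw [← Set.biUnion_preimage_singleton]
    exact hS.biUnion fun w _ => hfib w
  set F := {x | q x = x} with hF
  obtain ⟨b, hb⟩ : ∃ b, b ∉ F ∪ q ⁻¹' F ∪ q ⁻¹' (q ⁻¹' F) := by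
    by_contra! hcon
    have hun : F ∪ q ⁻¹' F ∪ q ⁻¹' (q ⁻¹' F) = Set.univ := Set.eq_univ_of_forall hcon
    refine cube_open_uncountable hm Set.univ isOpen_univ
      ⟨⟨fun _ => 0, fun _ => by simp⟩, trivial⟩ ?_
    rw [← hun]
    exact (hfix.union (hpre _ hfix)).union (hpre _ (hpre _ hfix))
  simp only [Set.mem_union, not_or] at hb
  obtain ⟨⟨hb1, hb2⟩, hb3⟩ := hb
  obtain ⟨a, ha⟩ : ∃ a, a = q b := ⟨_, rfl⟩
  obtain ⟨x0, hx0⟩ : ∃ x0, x0 = q a := ⟨_, rfl⟩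
  have hba : b ≠ a := fun e => hb1 (ha.symm.trans e.symm)
  have hax : x0 ≠ a := fun e => hb2 (by
    show q (q b) = q b
    rw [← ha, ← hx0]; exact e)
  have hqx : q x0 ≠ x0 := fun e => hb3 (by
    show q (q (q b)) = q (q b)
    rw [← ha, ← hx0]; exact e)
  obtain ⟨δ₁, hδ₁, hunif⟩ := Metric.uniformContinuous_iff.1
    (CompactSpace.uniformContinuous_of_continuous q.continuous) (ε / 2) (by positivity)
  obtain ⟨δ, hδ, hd1, hd2, hd3⟩ : ∃ δ : ℝ, 0 < δ ∧ 2 * δ < δ₁ ∧ 2 * δ ≤ dist b a ∧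
      2 * δ ≤ dist x0 a := by
    have p1 : 0 < dist b a := dist_pos.2 hba
    have p2 : 0 < dist x0 a := dist_pos.2 hax
    refine ⟨min (δ₁ / 4) (min (dist b a / 2) (dist x0 a / 2)), by positivity, ?_, ?_, ?_⟩
    · have := min_le_left (δ₁ / 4) (min (dist b a / 2) (dist x0 a / 2)); linarith
    · have := (min_le_right (δ₁ / 4) (min (dist b a / 2) (dist x0 a / 2))).trans (min_le_left _ _)
      linarith
    · have := (min_le_right (δ₁ / 4) (min (dist b a / 2) (dist x0 a / 2))).trans (min_le_right _ _)
      linarith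
  obtain ⟨r, hr1, hr2, hr3, hr4⟩ := exists_collapse a δ hδ
  have hfw : ∀ w, w ≠ x0 → ((q.comp r) ⁻¹' {w}).Countable := by
    intro w hw
    have hne : ∀ x, q (r x) = w → r x ≠ a := fun x hx e => hw (by rw [← hx, e, hx0])
    refine Set.MapsTo.countable_of_injOn (f := r) (t := q ⁻¹' {w}) ?_ ?_ (hfib w)
    · intro x hx; exact hx
    · intro x hx y hy hxy
      exact hr4 x y hxy (hne x hx)
  refine ⟨q.comp r, hball ?_, fun n hn => ?_⟩
  · rw [Metric.mem_ball, ContinuousMap.dist_lt_iff hε]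
    intro x
    have h1 : dist (q (r x)) (q x) < ε / 2 := hunif ((hr1 x).trans_lt hd1)
    have h2 := dist_triangle (q (r x)) (q x) (h x)
    have h3 := hq x
    show dist (q (r x)) (h x) < ε
    linarith
  · refine no_root _ x0 ?_ hfw ?_ n hn
    · show q (r x0) ≠ x0
      rw [hr3 x0 hd3]; exact hqx
    · intro hc
      set V : Set (CubeX m) := (q.comp r) ⁻¹' (Metric.ball a δ ∩ {x0}ᶜ) with hV
      have hVo : IsOpen V :=
        (Metric.isOpen_ball.inter isOpen_compl_singleton).preimage (q.comp r).continuous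
      have hbV : b ∈ V := by
        have : (q.comp r) b = a := by
          show q (r b) = a
          rw [hr3 b hd2, ha]
        show (q.comp r) b ∈ (Metric.ball a δ ∩ {x0}ᶜ)
        rw [this]
        exact ⟨Metric.mem_ball_self hδ, fun e => hax e.symm⟩
      refine cube_open_uncountable hm V hVo ⟨b, hbV⟩ ?_
      have h1 : (⋃ w ∈ (((q.comp r) ⁻¹' {x0} ∩ Set.range (q.comp r)) \ {x0}),
          (q.comp r) ⁻¹' {w}).Countable :=
        (hc.mono Set.sdiff_subset).biUnion fun w hw => hfw w hw.2
      refine h1.mono fun v hv => ?_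
      simp only [Set.mem_iUnion]
      refine ⟨(q.comp r) v, ⟨⟨?_, v, rfl⟩, hv.2⟩, rfl⟩
      show q (r ((q.comp r) v)) = x0
      rw [hr2 _ hv.1, hx0]
end

section
/- Let m ≥ 1 and let X = [0,1]^m be the unit cube in ℝ^m, and endow the space C(X) of continuous self-maps of X with the compact-open topology. Then the set of non-iterates, i.e., the complement in C(X) of W(X) = {fⁿ : f ∈ C(X), n ≥ 2}, is dense in C(X). -/
open Set Metric Topology

/-- The unit cube. -/
abbrev QCube (m : ℕ) := {x : Fin m → ℝ // ∀ i, x i ∈ Set.Icc (0 : ℝ) 1}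

/-- Abstract obstruction to being an iterate. -/
lemma no_root_of_light {X : Type*} [TopologicalSpace X] [T1Space X] (F g : X → X)
    (hg : Continuous g) (n : ℕ) (hn : 2 ≤ n) (hF : F = g^[n]) (x0 : X) (hx0 : F x0 ≠ x0)
    (hfin : ∀ y, y ≠ x0 → (F ⁻¹' {y}).Finite) (C D : Set X) (hC : IsPreconnected C)
    (hCF : ∀ x ∈ C, F x = x0) (hD : IsPreconnected D) (hDC : ∀ x ∈ D, F x ∈ C)
    (hDn : (F '' D).Nontrivial) : False := by
  have hcomm : ∀ x, F (g x) = g (F x) := by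
    intro x
    rw [hF, ← Function.iterate_succ_apply, Function.iterate_succ_apply']
  have key : ∀ (S : Set X) (y : X), IsPreconnected S → S.Nontrivial → (∀ x ∈ S, F x = y) →
      y = x0 := by
    intro S y hS hSn hy
    by_contra hne
    exact hS.infinite_of_nontrivial hSn ((hfin y hne).subset (fun x hx => hy x hx))
  have hgx0 : g x0 ≠ x0 := by
    intro h
    apply hx0
    rw [hF]
    exact Function.iterate_fixed h n
  have hgC : (g '' C).Subsingleton := by
    by_contra hns
    rw [Set.not_subsingleton_iff] at hns
    apply hgx0
    apply key (g '' C) (g x0) (hC.image g hg.continuousOn) hns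
    rintro _ ⟨x, hx, rfl⟩
    rw [hcomm, hCF x hx]
  obtain ⟨_, ⟨d, hd, rfl⟩, -⟩ := id hDn
  have hy : ∀ x ∈ D, g (F x) = g (F d) := fun x hx =>
    hgC ⟨_, hDC x hx, rfl⟩ ⟨_, hDC d hd, rfl⟩
  have hnon : ∀ j ≤ n, (g^[j] '' D).Nontrivial := by
    intro j hj
    have : F '' D = g^[n - j] '' (g^[j] '' D) := by
      rw [← Set.image_comp, ← Function.iterate_add, Nat.sub_add_cancel hj, hF]
    rw [this] at hDn
    exact Set.nontrivial_of_image _ _ hDn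
  have h1 : g (F d) = x0 := by
    apply key (g^[1] '' D) _ (hD.image _ (hg.iterate 1).continuousOn) (hnon 1 (by omega))
    rintro _ ⟨x, hx, rfl⟩
    simp only [Function.iterate_one]
    rw [hcomm, hy x hx]
  have h2 : g (g (F d)) = x0 := by
    apply key (g^[2] '' D) _ (hD.image _ (hg.iterate 2).continuousOn) (hnon 2 hn)
    rintro _ ⟨x, hx, rfl⟩
    simp only [Function.iterate_succ, Function.iterate_zero, Function.comp, id]
    rw [hcomm, hcomm, hy x hx]
  rw [h1] at h2
  exact hgx0 h2

/-- Sawtooth. -/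
noncomputable def saw (t : ℝ) : ℝ := ‖(t : UnitAddCircle)‖

lemma saw_cont : Continuous saw := by
  unfold saw
  exact continuous_norm.comp (AddCircle.continuous_mk' 1)

lemma saw_nonneg (t : ℝ) : 0 ≤ saw t := norm_nonneg _

lemma saw_le (t : ℝ) : saw t ≤ 1 := by
  unfold saw
  rw [UnitAddCircle.norm_eq]
  have := abs_sub_round t
  linarith

lemma saw_cell (s t : ℝ) (h : ⌊2 * s⌋ = ⌊2 * t⌋) : |saw s - saw t| = |s - t| := by
  have aux : ∀ (k : ℤ) (u : ℝ), ((k : ℝ) ≤ u → u < k + 1 / 2 → saw u = u - k) ∧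
      ((k : ℝ) + 1 / 2 ≤ u → u < k + 1 → saw u = k + 1 - u) := by
    intro k u
    unfold saw
    rw [UnitAddCircle.norm_eq, round_eq]
    constructor
    · intro h1 h2
      have : ⌊u + 1 / 2⌋ = k := by
        rw [Int.floor_eq_iff]; constructor <;> linarith
      rw [this, abs_of_nonneg (by linarith)]
    · intro h1 h2
      have : ⌊u + 1 / 2⌋ = k + 1 := by
        rw [Int.floor_eq_iff]; push_cast; constructor <;> linarith
      rw [this, abs_of_nonpos (by push_cast; linarith)]
      push_cast; ring
  have hs1 := Int.floor_le (2 * s)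
  have hs2 := Int.lt_floor_add_one (2 * s)
  have ht1 := Int.floor_le (2 * t)
  have ht2 := Int.lt_floor_add_one (2 * t)
  rw [← h] at ht1 ht2
  rcases Int.even_or_odd' ⌊2 * s⌋ with ⟨k, hk | hk⟩
  · rw [hk] at hs1 hs2 ht1 ht2
    push_cast at hs1 hs2 ht1 ht2
    rw [(aux k s).1 (by linarith) (by linarith), (aux k t).1 (by linarith) (by linarith)]
    congr 1; ring
  · rw [hk] at hs1 hs2 ht1 ht2
    push_cast at hs1 hs2 ht1 ht2
    rw [(aux k s).2 (by linarith) (by linarith), (aux k t).2 (by linarith) (by linarith),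
      abs_sub_comm]
    congr 1; ring

instance qcube_compact (m : ℕ) : CompactSpace (QCube m) := by
  have : IsCompact {x : Fin m → ℝ | ∀ i, x i ∈ Set.Icc (0 : ℝ) 1} := by
    have h := isCompact_univ_pi (fun _ : Fin m => (isCompact_Icc : IsCompact (Set.Icc (0 : ℝ) 1)))
    have e : {x : Fin m → ℝ | ∀ i, x i ∈ Set.Icc (0 : ℝ) 1} =
        Set.univ.pi fun _ : Fin m => Set.Icc (0 : ℝ) 1 := by
      ext x; simp only [Set.mem_pi, Set.mem_ofPred_eq, Set.mem_univ, true_imp_iff]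
    rw [e]; exact h
  exact isCompact_iff_compactSpace.mp this

instance qcube_nonempty (m : ℕ) : Nonempty (QCube m) := ⟨⟨fun _ => 0, by simp⟩⟩

lemma qcube_convex (m : ℕ) : Convex ℝ {x : Fin m → ℝ | ∀ i, x i ∈ Set.Icc (0 : ℝ) 1} := by
  have h := convex_pi (s := Set.univ) (t := fun _ : Fin m => Set.Icc (0 : ℝ) 1)
    (𝕜 := ℝ) (fun i _ => convex_Icc (0 : ℝ) 1)
  have e : {x : Fin m → ℝ | ∀ i, x i ∈ Set.Icc (0 : ℝ) 1} =
      Set.univ.pi fun _ : Fin m => Set.Icc (0 : ℝ) 1 := by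
    ext x; simp only [Set.mem_pi, Set.mem_ofPred_eq, Set.mem_univ, true_imp_iff]
  rw [e]; exact h

lemma qcube_ball (m : ℕ) (d : QCube m) (r : ℝ) : IsPreconnected (ball d r) := by
  have hi : Topology.IsInducing (Subtype.val : QCube m → Fin m → ℝ) := ⟨rfl⟩
  rw [← hi.isPreconnected_image]
  have : (Subtype.val '' (ball d r)) =
      ball (d : Fin m → ℝ) r ∩ {x : Fin m → ℝ | ∀ i, x i ∈ Set.Icc (0 : ℝ) 1} := by
    ext x
    constructor
    · rintro ⟨y, hy, rfl⟩
      exact ⟨hy, y.2⟩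
    · rintro ⟨h1, h2⟩
      exact ⟨⟨x, h2⟩, h1, rfl⟩
  rw [this]
  exact ((convex_ball _ _).inter (qcube_convex m)).isPreconnected

lemma qcube_dist_le_one (m : ℕ) (x y : QCube m) : dist x y ≤ 1 := by
  rw [Subtype.dist_eq, dist_pi_le_iff zero_le_one]
  intro i
  rw [Real.dist_eq, abs_le]
  have := (x.2 i); have := y.2 i
  simp only [Set.mem_Icc] at *
  constructor <;> linarith

lemma qcube_coord_le (m : ℕ) (x y : QCube m) (i : Fin m) : |x.1 i - y.1 i| ≤ dist x y := by
  rw [Subtype.dist_eq, ← Real.dist_eq]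
  exact dist_le_pi_dist _ _ i

/-- Lipschitz approximation by inf-convolution. -/
lemma lip_approx {X : Type*} [MetricSpace X] [CompactSpace X] [Nonempty X] (f : X → ℝ)
    (hf : Continuous f) (h01 : ∀ x, f x ∈ Set.Icc (0 : ℝ) 1) (ε : ℝ) (hε : 0 < ε) :
    ∃ L0 : ℝ, 0 ≤ L0 ∧ ∀ L, L0 ≤ L → ∃ h : X → ℝ, (∀ x, h x ∈ Set.Icc (0 : ℝ) 1) ∧
      (∀ x y, |h x - h y| ≤ L * dist x y) ∧ ∀ x, |h x - f x| ≤ ε := by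
  have huc := CompactSpace.uniformContinuous_of_continuous hf
  rw [Metric.uniformContinuous_iff] at huc
  obtain ⟨δ, hδ, hδf⟩ := huc ε hε
  refine ⟨1 / δ, by positivity, fun L hL => ?_⟩
  have hL0 : 0 ≤ L := le_trans (by positivity) hL
  have hLδ : 1 ≤ L * δ := by
    rw [div_le_iff₀ hδ] at hL; exact hL
  have hbdd : ∀ x, BddBelow (Set.range fun y => f y + L * dist x y) := by
    intro x
    refine ⟨0, ?_⟩
    rintro _ ⟨y, rfl⟩
    have := (h01 y).1
    have : 0 ≤ L * dist x y := by positivity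
    simp only
    linarith
  have hle : ∀ x, (⨅ y, f y + L * dist x y) ≤ f x := by
    intro x
    have := ciInf_le (hbdd x) x
    simpa using this
  have h1 : ∀ x y, (⨅ z, f z + L * dist x z) ≤ (⨅ z, f z + L * dist y z) + L * dist x y := by
    intro x y
    rw [← sub_le_iff_le_add]
    apply le_ciInf
    intro z
    have := ciInf_le (hbdd x) z
    have h3 := mul_le_mul_of_nonneg_left (dist_triangle x y z) hL0
    linarith
  refine ⟨fun x => ⨅ y, f y + L * dist x y, ?_, ?_, ?_⟩
  · intro x
    refine ⟨?_, (hle x).trans (h01 x).2⟩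
    apply le_ciInf
    intro y
    have := (h01 y).1
    positivity
  · intro x y
    rw [abs_le]
    have a := h1 x y
    have b := h1 y x
    rw [dist_comm y x] at b
    constructor <;> linarith
  · intro x
    rw [abs_le]
    refine ⟨?_, by linarith [hle x]⟩
    suffices f x - ε ≤ ⨅ y, f y + L * dist x y by linarith
    apply le_ciInf
    intro y
    by_cases hxy : dist x y < δ
    · have := hδf hxy
      rw [Real.dist_eq, abs_lt] at this
      have : 0 ≤ L * dist x y := by positivity
      linarith
    · push Not at hxy
      have := mul_le_mul_of_nonneg_left hxy hL0
      have := (h01 y).1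
      have := (h01 x).2
      linarith

/-- Approximation by maps with finite fibres and finitely many fixed points. -/
lemma light_approx (m : ℕ) (f : C(QCube m, QCube m)) (ε : ℝ) (hε : 0 < ε) (hε1 : ε < 1) :
    ∃ G : C(QCube m, QCube m), (∀ x, dist (G x) (f x) ≤ 3 * ε) ∧
      (∀ y, (G ⁻¹' {y}).Finite) ∧ {x | G x = x}.Finite := by
  have hfi : ∀ i : Fin m, Continuous fun x => (f x).1 i := fun i =>
    (continuous_apply i).comp (continuous_subtype_val.comp f.continuous)
  choose L0 hL0 hL using fun i : Fin m =>
    lip_approx (fun x => (f x).1 i) (hfi i) (fun x => (f x).2 i) ε hε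
  set L : ℝ := ∑ i, L0 i with hLdef
  have hLi : ∀ i, L0 i ≤ L := fun i =>
    Finset.single_le_sum (f := L0) (fun j _ => hL0 j) (Finset.mem_univ i)
  have hLpos : 0 ≤ L := Finset.sum_nonneg fun j _ => hL0 j
  choose h h01 hlip happ using fun i => hL i L (hLi i)
  set M : ℝ := L + 2 with hM
  have hMpos : 0 < M := by linarith
  obtain ⟨N, hN⟩ := exists_nat_gt (M / ε)
  have hNpos : (0 : ℝ) < N := lt_trans (by positivity) hN
  have hMN : M / N ≤ ε := by
    rw [div_le_iff₀ hNpos]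
    rw [div_lt_iff₀ hε] at hN
    linarith
  let W : ℝ → ℝ := fun t => M / N * saw (N * t)
  have hW0 : ∀ t, 0 ≤ W t := fun t => mul_nonneg (by positivity) (saw_nonneg _)
  have hW1 : ∀ t, W t ≤ ε := fun t => by
    have := mul_le_mul_of_nonneg_left (saw_le (N * t)) (show 0 ≤ M / N by positivity)
    simp only [W]; linarith
  have hWcell : ∀ s t : ℝ, ⌊2 * ((N : ℝ) * s)⌋ = ⌊2 * ((N : ℝ) * t)⌋ → |W s - W t| = M * |s - t| := by
    intro s t hst
    simp only [W]
    rw [← mul_sub, abs_mul, saw_cell _ _ hst, ← mul_sub, abs_mul, abs_of_pos hNpos,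
      abs_of_nonneg (show 0 ≤ M / N by positivity)]
    field_simp
  have hWc : Continuous W := continuous_const.mul (saw_cont.comp (continuous_const.mul continuous_id))
  have hhc : ∀ i, Continuous (h i) := fun i =>
    (LipschitzWith.of_dist_le_mul (K := ⟨L, hLpos⟩) (fun x y => by
      rw [Real.dist_eq]; exact hlip i x y)).continuous
  let G0 : QCube m → QCube m := fun x => ⟨fun i => (1 - ε) * h i x + W (x.1 i), fun i => by
    have a := h01 i x
    have b := hW0 (x.1 i)
    have c := hW1 (x.1 i)
    constructor
    · have := mul_nonneg (show 0 ≤ 1 - ε by linarith) a.1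
      linarith
    · have := mul_le_mul_of_nonneg_left a.2 (show 0 ≤ 1 - ε by linarith)
      linarith⟩
  have hG0 : Continuous G0 := by
    apply Continuous.subtype_mk
    apply continuous_pi
    intro i
    exact (continuous_const.mul (hhc i)).add
      (hWc.comp ((continuous_apply i).comp continuous_subtype_val))
  have hfinite : ∀ T : Set (QCube m), (∀ x ∈ T, ∀ y ∈ T, ∀ i, |(G0 x).1 i - (G0 y).1 i| ≤ dist x y) →
      T.Finite := by
    intro T hT
    have hfs : (Set.univ.pi fun _ : Fin m => Set.Icc (0 : ℤ) ⌊2 * (N : ℝ)⌋).Finite :=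
      Set.Finite.pi fun _ => Set.finite_Icc _ _
    refine Set.Finite.of_injOn (f := fun (x : QCube m) (i : Fin m) => ⌊2 * ((N : ℝ) * x.1 i)⌋)
      ?_ ?_ hfs
    · intro x _ i _
      have := x.2 i
      constructor
      · apply Int.floor_nonneg.mpr
        have := this.1
        positivity
      · apply Int.floor_le_floor
        have := mul_le_mul_of_nonneg_left this.2 hNpos.le
        linarith
    · intro x hx y hy hxy
      have hbound : ∀ i, M * |x.1 i - y.1 i| ≤ (L + 1) * dist x y := by
        intro i
        rw [← hWcell _ _ (congrFun hxy i)]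
        have e : W (x.1 i) - W (y.1 i) = ((G0 x).1 i - (G0 y).1 i) - (1 - ε) * (h i x - h i y) := by
          simp only [G0]; ring
        rw [e]
        have a := abs_sub ((G0 x).1 i - (G0 y).1 i) ((1 - ε) * (h i x - h i y))
        have b := hT x hx y hy i
        have c : |(1 - ε) * (h i x - h i y)| ≤ L * dist x y := by
          rw [abs_mul, abs_of_pos (by linarith : 0 < 1 - ε)]
          have := hlip i x y
          have := mul_le_of_le_one_left (abs_nonneg (h i x - h i y)) (by linarith : 1 - ε ≤ 1)
          linarith
        linarith
      have : dist x y ≤ (L + 1) * dist x y / M := by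
        rw [Subtype.dist_eq, dist_pi_le_iff (by positivity)]
        intro i
        rw [le_div_iff₀ hMpos, Real.dist_eq, mul_comm]
        exact hbound i
      rw [le_div_iff₀ hMpos] at this
      have h0 : dist x y ≤ 0 := by rw [hM] at this; linarith
      exact dist_le_zero.mp h0
  refine ⟨⟨G0, hG0⟩, ?_, ?_, ?_⟩
  · intro x
    rw [Subtype.dist_eq, dist_pi_le_iff (by positivity)]
    intro i
    rw [Real.dist_eq]
    have a := happ i x
    have b := hW0 (x.1 i)
    have c := hW1 (x.1 i)
    have d := h01 i x
    have e1 := mul_nonneg hε.le d.1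
    have e2 := mul_le_mul_of_nonneg_left d.2 hε.le
    simp only [ContinuousMap.coe_mk, G0]
    rw [abs_le] at a ⊢
    constructor <;> linarith
  · intro y
    apply hfinite
    intro x hx x' hx' i
    have hx : G0 x = y := hx
    have hx' : G0 x' = y := hx'
    rw [hx, hx']
    simp
  · apply hfinite
    intro x hx x' hx' i
    have hx : G0 x = x := hx
    have hx' : G0 x' = x' := hx'
    rw [hx, hx']
    exact qcube_coord_le m x x' i

/-- Collapsing a small ball to its centre. -/
lemma collapse (m : ℕ) (c : QCube m) (r : ℝ) (hr : 0 < r) :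
    ∃ φ : C(QCube m, QCube m), (∀ x, dist x c ≤ r → φ x = c) ∧ (∀ x, 2 * r ≤ dist x c → φ x = x) ∧
      (∀ x, dist (φ x) x ≤ 2 * r) ∧ Set.InjOn φ (φ ⁻¹' {c}ᶜ) := by
  let k : ℝ → ℝ := fun s => min 1 (2 - 2 * r / max s r)
  have hpos : ∀ s, 0 < max s r := fun s => lt_max_of_lt_right hr
  have hk0 : ∀ s, 0 ≤ k s := fun s => by
    refine le_min zero_le_one ?_
    have : 2 * r / max s r ≤ 2 := by
      rw [div_le_iff₀ (hpos s)]
      linarith [le_max_right s r]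
    linarith
  have hk1 : ∀ s, k s ≤ 1 := fun s => min_le_left _ _
  have hkc : Continuous k := by
    refine continuous_const.min (continuous_const.sub (continuous_const.div
      (continuous_id.max continuous_const) (fun s => (hpos s).ne')))
  have hksmall : ∀ s, s ≤ r → k s = 0 := fun s hs => by
    simp only [k]
    rw [max_eq_right hs, mul_div_assoc, div_self hr.ne']
    norm_num
  have hkbig : ∀ s, 2 * r ≤ s → k s = 1 := fun s hs => by
    simp only [k]
    rw [max_eq_left (by linarith)]
    apply min_eq_left
    have : 2 * r / s ≤ 1 := by
      rw [div_le_one (by linarith)]; exact hs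
    linarith
  have hks : ∀ s, r ≤ s → k s * s = min s (2 * s - 2 * r) := fun s hs => by
    have hs0 : 0 < s := by linarith
    simp only [k]
    rw [max_eq_left hs, min_mul_of_nonneg _ _ hs0.le]
    congr 1
    · ring
    · field_simp
  let φ0 : QCube m → QCube m := fun x => ⟨c.1 + k (dist x c) • (x.1 - c.1), by
    have := (qcube_convex m).add_smul_sub_mem c.2 x.2 ⟨hk0 (dist x c), hk1 (dist x c)⟩
    exact this⟩
  have hφc : Continuous φ0 := by
    apply Continuous.subtype_mk
    exact continuous_const.add ((hkc.comp (continuous_id.dist continuous_const)).smul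
      (continuous_subtype_val.sub continuous_const))
  have hφd : ∀ x, dist (φ0 x) c = k (dist x c) * dist x c := by
    intro x
    have : dist (φ0 x) c = ‖k (dist x c) • (x.1 - c.1)‖ := by
      rw [Subtype.dist_eq, dist_eq_norm]
      simp [φ0]
    rw [this, norm_smul, Real.norm_of_nonneg (hk0 _), ← dist_eq_norm, ← Subtype.dist_eq]
  have hbig : ∀ x, 2 * r ≤ dist x c → φ0 x = x := by
    intro x hx
    apply Subtype.ext
    simp only [φ0]
    rw [hkbig _ hx, one_smul]
    abel
  refine ⟨⟨φ0, hφc⟩, ?_, hbig, ?_, ?_⟩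
  · intro x hx
    apply Subtype.ext
    simp only [φ0, ContinuousMap.coe_mk]
    rw [hksmall _ hx, zero_smul, add_zero]
  · intro x
    by_cases hx : 2 * r ≤ dist x c
    · have := hbig x hx
      simp only [ContinuousMap.coe_mk]
      rw [this, dist_self]
      positivity
    · push Not at hx
      have : dist (φ0 x) x = ‖(k (dist x c) - 1) • (x.1 - c.1)‖ := by
        rw [Subtype.dist_eq, dist_eq_norm]
        congr 1
        simp only [φ0]
        rw [sub_smul, one_smul]
        abel
      simp only [ContinuousMap.coe_mk]
      rw [this, norm_smul, ← dist_eq_norm x.1 c.1, ← Subtype.dist_eq, Real.norm_eq_abs,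
        abs_of_nonpos (by linarith [hk1 (dist x c)])]
      have := mul_le_of_le_one_left (dist_nonneg (x := x) (y := c))
        (show -(k (dist x c) - 1) ≤ 1 by linarith [hk0 (dist x c)])
      linarith
  · have hgt : ∀ x, φ0 x ≠ c → r < dist x c := by
      intro x hx
      by_contra hle
      push Not at hle
      apply hx
      rw [← dist_eq_zero, hφd, hksmall _ hle, zero_mul]
    have hsm : ∀ s t, r < s → r < t → k s * s = k t * t → s ≤ t := by
      intro s t hs ht h
      by_contra! hlt
      rw [hks s hs.le, hks t ht.le] at h
      have : min t (2 * t - 2 * r) < min s (2 * s - 2 * r) :=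
        min_lt_min hlt (by linarith)
      linarith
    intro x hx y hy hxy
    have hx : φ0 x ≠ c := hx
    have hy : φ0 y ≠ c := hy
    have hxy : φ0 x = φ0 y := hxy
    have hd : k (dist x c) * dist x c = k (dist y c) * dist y c := by
      rw [← hφd, ← hφd, hxy]
    have hdd : dist x c = dist y c :=
      le_antisymm (hsm _ _ (hgt x hx) (hgt y hy) hd) (hsm _ _ (hgt y hy) (hgt x hx) hd.symm)
    have hkne : k (dist y c) ≠ 0 := by
      intro h0
      apply hy
      rw [← dist_eq_zero, hφd, h0, zero_mul]
    have := congrArg Subtype.val hxy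
    simp only [φ0] at this
    rw [hdd] at this
    have h3 := smul_right_injective (Fin m → ℝ) hkne (add_left_cancel this)
    exact Subtype.ext (sub_left_injective h3)

/-- **Density of non-iterates for the unit cube.** For `X = [0,1]^m`, the
complement in `C(X)` of `W(X) = {fⁿ : f ∈ C(X), n ≥ 2}` is dense in `C(X)`
(compact-open topology). -/
theorem dense_non_iterates_cube (m : ℕ) (hm : 1 ≤ m) :
    Dense ({F : C({x : Fin m → ℝ // ∀ i, x i ∈ Set.Icc (0 : ℝ) 1},
                  {x : Fin m → ℝ // ∀ i, x i ∈ Set.Icc (0 : ℝ) 1}) |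
        ∃ (g : C({x : Fin m → ℝ // ∀ i, x i ∈ Set.Icc (0 : ℝ) 1},
                 {x : Fin m → ℝ // ∀ i, x i ∈ Set.Icc (0 : ℝ) 1})) (n : ℕ),
          2 ≤ n ∧ ⇑F = (⇑g)^[n]}ᶜ) := by
  have hpre : PreconnectedSpace (QCube m) :=
    Subtype.preconnectedSpace (qcube_convex m).isPreconnected
  have hnt : Nontrivial (QCube m) := by
    refine ⟨⟨fun _ => 0, by simp⟩, ⟨fun _ => 1, by simp⟩, ?_⟩
    intro h
    have := congrFun (congrArg Subtype.val h) ⟨0, hm⟩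
    simp at this
  have hconn : ConnectedSpace (QCube m) := { toNonempty := inferInstance }
  have hinf : ∀ (x : QCube m) (s : Set (QCube m)), s ∈ 𝓝 x → s.Infinite :=
    fun x s hs => infinite_of_mem_nhds x hs
  rw [Metric.dense_iff]
  intro f ε hε
  obtain ⟨G, hGf, hGfin, hGfix⟩ := light_approx m f (min (ε / 8) (1 / 2)) (by positivity)
    (lt_of_le_of_lt (min_le_right _ _) (by norm_num))
  have hGf' : ∀ x, dist (G x) (f x) ≤ 3 * (ε / 8) := fun x =>
    (hGf x).trans (by linarith [min_le_left (ε / 8) (1 / 2 : ℝ)])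
  obtain ⟨d, hd⟩ : ∃ d, G (G (G d)) ≠ G (G d) := by
    by_contra! hall
    have h1 : (G ⁻¹' (G ⁻¹' {x | G x = x})).Finite := by
      have hp : ∀ S : Set (QCube m), S.Finite → (G ⁻¹' S).Finite := by
        intro S hS
        exact hS.preimage' (fun b _ => hGfin b)
      exact hp _ (hp _ hGfix)
    have h2 : (G ⁻¹' (G ⁻¹' {x | G x = x})) = Set.univ := by
      ext x; simpa using hall x
    rw [h2] at h1
    exact hinf (Classical.arbitrary _) _ Filter.univ_mem h1
  set c := G d with hc
  set x0 := G c with hx0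
  have hx0c : x0 ≠ c := by
    intro h
    apply hd
    rw [h]
    exact h
  have hdc : d ≠ c := by
    intro h
    apply hx0c
    rw [hx0]
    calc G c = G d := by rw [← h]
      _ = c := rfl
  have huc := CompactSpace.uniformContinuous_of_continuous G.continuous
  rw [Metric.uniformContinuous_iff] at huc
  obtain ⟨δ, hδ, hδG⟩ := huc (ε / 8) (by positivity)
  have hp1 := dist_pos.mpr hx0c
  have hp2 := dist_pos.mpr hdc
  obtain ⟨r, hr, hr1⟩ : ∃ r : ℝ, 0 < r ∧ 2 * r < min δ (min (dist x0 c) (dist d c)) := by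
    have : 0 < min δ (min (dist x0 c) (dist d c)) := by positivity
    exact ⟨min δ (min (dist x0 c) (dist d c)) / 4, by positivity, by linarith⟩
  rw [lt_min_iff, lt_min_iff] at hr1
  obtain ⟨hrδ, hrx, hrd⟩ := hr1
  obtain ⟨φ, hφ1, hφ2, hφ3, hφ4⟩ := collapse m c r hr
  have hFfin : ∀ y, y ≠ x0 → ((G.comp φ) ⁻¹' {y}).Finite := by
    intro y hy
    have : ((G.comp φ) ⁻¹' {y}) = φ ⁻¹' (G ⁻¹' {y}) := rfl
    rw [this]
    apply (hGfin y).preimage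
    apply hφ4.mono
    intro x hx hxc
    apply hy
    have h1 : G (φ x) = y := hx
    have h2 : φ x = c := hxc
    rw [← h1, h2]
  refine ⟨G.comp φ, ?_, ?_⟩
  · rw [Metric.mem_ball, ContinuousMap.dist_lt_iff hε]
    intro x
    have h1 : dist (G (φ x)) (G x) < ε / 8 := hδG ((hφ3 x).trans_lt hrδ)
    have h2 := hGf' x
    have h3 := dist_triangle (G (φ x)) (G x) (f x)
    simp only [ContinuousMap.comp_apply]
    linarith
  · rintro ⟨g, n, hn, hgn⟩
    have hFd : (G.comp φ) d = c := by
      rw [ContinuousMap.comp_apply, hφ2 d hrd.le]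
    have hnb : (G.comp φ) ⁻¹' (ball c r) ∈ 𝓝 d := by
      apply (G.comp φ).continuous.continuousAt
      rw [hFd]
      exact ball_mem_nhds c hr
    obtain ⟨ρ, hρ, hρb⟩ := Metric.mem_nhds_iff.mp hnb
    refine no_root_of_light (G.comp φ) g g.continuous n hn hgn x0 ?_ hFfin (ball c r) (ball d ρ)
      (qcube_ball m c r) ?_ (qcube_ball m d ρ) (fun x hx => hρb hx) ?_
    · rw [ContinuousMap.comp_apply, hφ2 x0 hrx.le]
      exact hd
    · intro x hx
      rw [ContinuousMap.comp_apply, hφ1 x (le_of_lt hx)]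
    · rw [← Set.not_subsingleton_iff]
      intro hs
      apply hinf d (ball d ρ) (ball_mem_nhds d hρ)
      apply (hFfin c hx0c.symm).subset
      intro x hx
      have := hs ⟨x, hx, rfl⟩ ⟨d, mem_ball_self hρ, rfl⟩
      rw [hFd] at this
      exact this
end

section
/- There exist a Lebesgue-measurable set X ⊆ ℝ, a measurable map f : X → X, and a point x₀ ∈ X such that: f(x₀) ≠ x₀; the set f⁻²(x₀) has positive Lebesgue measure; for every x ∈ X with x ≠ x₀ the set f⁻¹(x) has Lebesgue measure zero; f maps sets of Lebesgue measure zero to sets of Lebesgue measure zero; and yet f has a measurable iterative square root, i.e., there exists a measurable g : X → X with g ∘ g = f. (Hence the natural measure-theoretic analogue of the cardinality-based non-existence criterion for iterative roots fails.) -/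
open MeasureTheory

lemma exists_emb_null : ∃ e : ℝ → ℝ, MeasurableEmbedding e ∧ volume (Set.range e) = 0 ∧
    (∀ y, Irrational (e y)) := by
  have hm : MeasurableSet {x : ℝ | Liouville x} := IsGδ.setOfPred_liouville.measurableSet
  have hunc : ¬ Countable {x : ℝ | Liouville x} := by
    intro hc
    have hc : Set.Countable {x : ℝ | Liouville x} := hc
    have h1 : {x : ℝ | Liouville x} ∈ residual ℝ := eventually_residual_liouville
    have h2 : {x : ℝ | Liouville x}ᶜ ∈ residual ℝ := by
      have : {x : ℝ | Liouville x}ᶜ = ⋂ a ∈ {x : ℝ | Liouville x}, {a}ᶜ := by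
        ext x; simp; grind
      rw [this, countable_bInter_mem hc]
      intro a _
      exact residual_of_dense_open isOpen_compl_singleton (dense_compl_singleton a)
    have h3 := Filter.inter_mem h1 h2
    rw [Set.inter_compl_self] at h3
    have := (dense_of_mem_residual h3).nonempty
    simp at this
  have : StandardBorelSpace {x : ℝ | Liouville x} := hm.standardBorel
  have hR : ¬ Countable ℝ := not_countable_iff.2 inferInstance
  let E : ℝ ≃ᵐ {x : ℝ | Liouville x} := PolishSpace.measurableEquivOfNotCountable hR hunc
  refine ⟨fun y => (E y : ℝ),
    (MeasurableEmbedding.subtype_coe hm).comp E.measurableEmbedding, ?_, ?_⟩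
  · refine measure_mono_null ?_ volume_setOfPred_liouville
    rintro _ ⟨y, rfl⟩
    exact (E y).2
  · intro y
    exact Liouville.irrational (E y).2

/-- **Example 7.** There exist a measurable set `X ⊆ ℝ`, a measurable map
`f : X → X` and a point `x₀ ∈ X` such that `f(x₀) ≠ x₀`, `f⁻²(x₀)` has
positive Lebesgue measure, `f⁻¹(x)` has Lebesgue measure zero for every
`x ≠ x₀`, `f` maps sets of measure zero to sets of measure zero, and yet `f`
has a measurable iterative square root. (Hence the measure-theoretic analogue
of the cardinality-based non-existence criterion for iterative roots fails.) -/
theorem exists_measurable_counterexample :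
    ∃ (X : Set ℝ) (f : X → X) (x₀ : X),
      MeasurableSet X ∧
      Measurable f ∧
      f x₀ ≠ x₀ ∧
      0 < volume (Subtype.val '' {y : X | f (f y) = x₀}) ∧
      (∀ x : X, x ≠ x₀ → volume (Subtype.val '' {y : X | f y = x}) = 0) ∧
      (∀ S : Set X, volume (Subtype.val '' S) = 0 →
        volume (Subtype.val '' (f '' S)) = 0) ∧
      ∃ g : X → X, Measurable g ∧ g ∘ g = f := by
  classical
  obtain ⟨e, he, hnull, hirr⟩ := exists_emb_null
  obtain ⟨d, hd, hde⟩ : ∃ d : ℝ → ℝ, Measurable d ∧ ∀ y, d (e y) = y :=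
    ⟨Function.extend e id 0, he.measurable_extend measurable_id measurable_const,
      fun y => he.injective.extend_apply id 0 y⟩
  have e0 : ∀ y, e y ≠ 0 := fun y => (hirr y).ne_zero
  have e1 : ∀ y, e y ≠ 1 := fun y => (hirr y).ne_one
  have e2 : ∀ y, e y ≠ 2 := fun y => (hirr y).ne_ofNat 2
  let G : ℝ → ℝ := fun x => if x = 0 then 1 else if x = 1 then 2 else if x = 2 then 2 else
    if x ∈ Set.range e then (if d x < 0 then e (-d x) else 0) else e (-Real.exp x)
  have hG : Measurable G := by
    have hem := he.measurable
    refine Measurable.ite (measurableSet_singleton 0) measurable_const ?_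
    refine Measurable.ite (measurableSet_singleton 1) measurable_const ?_
    refine Measurable.ite (measurableSet_singleton 2) measurable_const ?_
    refine Measurable.ite he.measurableSet_range ?_ (hem.comp Real.measurable_exp.neg)
    exact Measurable.ite (measurableSet_lt hd measurable_const) (hem.comp hd.neg) measurable_const
  have G0 : G 0 = 1 := by simp [G]
  have G1 : G 1 = 2 := by simp [G]
  have G2 : G 2 = 2 := by simp [G]
  have Gneg : ∀ y, y < 0 → G (e y) = e (-y) := by
    intro y hy
    simp [G, e0, e1, e2, hde, hy]
  have Gpos : ∀ y, 0 ≤ y → G (e y) = 0 := by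
    intro y hy
    simp [G, e0, e1, e2, hde, hy.not_gt]
  let N : Set ℝ := Set.range e ∪ {0, 1, 2}
  have hN : volume N = 0 :=
    measure_union_null hnull ((Set.toFinite ({0, 1, 2} : Set ℝ)).measure_zero _)
  have GN : ∀ x, x ∉ N → G x = e (-Real.exp x) := by
    intro x hx
    simp only [N, Set.mem_union, Set.mem_insert_iff, Set.mem_singleton_iff, not_or] at hx
    obtain ⟨h, h0, h1, h2⟩ := hx
    simp only [G, if_neg h, if_neg h0, if_neg h1, if_neg h2]
  have FN : ∀ x, x ∉ N → G (G x) = e (Real.exp x) := by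
    intro x hx
    rw [GN x hx, Gneg _ (by simpa using Real.exp_pos x), neg_neg]
  have G0N : ∀ x, G x ∈ N := by
    intro x
    by_cases hx : x ∈ N
    · rcases hx with ⟨y, rfl⟩ | rfl | rfl | rfl
      · rcases lt_or_ge y 0 with h | h
        · rw [Gneg y h]; exact Or.inl ⟨_, rfl⟩
        · rw [Gpos y h]; simp [N]
      · rw [G0]; simp [N]
      · rw [G1]; simp [N]
      · rw [G2]; simp [N]
    · rw [GN x hx]; exact Or.inl ⟨_, rfl⟩
  let g : ↥(Set.univ : Set ℝ) → ↥(Set.univ : Set ℝ) := fun x => ⟨G x, trivial⟩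
  have hg : Measurable g := (hG.comp measurable_subtype_coe).subtype_mk
  refine ⟨Set.univ, g ∘ g, ⟨1, trivial⟩, MeasurableSet.univ, hg.comp hg, ?_, ?_, ?_, ?_, g, hg, rfl⟩
  · intro h
    have h : G (G 1) = 1 := congrArg Subtype.val h
    rw [G1, G2] at h
    norm_num at h
  · have hsub : Nᶜ ⊆ Subtype.val '' {y : (Set.univ : Set ℝ) | (g ∘ g) ((g ∘ g) y) = ⟨1, trivial⟩} := by
      intro x hx
      refine ⟨⟨x, trivial⟩, ?_, rfl⟩
      refine Subtype.ext ?_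
      change G (G (G (G x))) = 1
      rw [FN x hx, Gpos _ (Real.exp_pos x).le, G0]
    refine lt_of_lt_of_le ?_ (measure_mono hsub)
    rw [pos_iff_ne_zero]
    intro h
    have : volume (N ∪ Nᶜ) = 0 := measure_union_null hN h
    simp at this
  · rintro ⟨x, _⟩ _
    by_cases hx : ∃ z, z ∉ N ∧ G (G z) = x
    · obtain ⟨z, hz, rfl⟩ := hx
      refine measure_mono_null ?_ (measure_union_null hN (measure_singleton z))
      rintro _ ⟨⟨y, _⟩, hy, rfl⟩
      by_cases hyN : y ∈ N
      · exact Or.inl hyN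
      · right
        have hy : G (G y) = G (G z) := congrArg Subtype.val hy
        rw [FN y hyN, FN z hz] at hy
        exact Real.exp_injective (he.injective hy)
    · refine measure_mono_null ?_ hN
      rintro _ ⟨⟨y, _⟩, hy, rfl⟩
      by_contra hyN
      exact hx ⟨y, hyN, congrArg Subtype.val hy⟩
  · intro S _
    refine measure_mono_null ?_ hN
    rintro _ ⟨_, ⟨y, _, rfl⟩, rfl⟩
    exact G0N _
end
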